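/- Let x̄ ∈ M_c be biactive, let SNO-LICQ hold at x̄, and suppose −∇f(x̄) ∈ N_{M_c}(x̄) (x̄ is limiting-normal stationary). Then −∇f(x̄) ∉ N̂_{M_c}(x̄) (x̄ is not Fréchet-stationary) if and only if x̄ is a singular saddle point of first order, i.e., there exist multipliers λ_{1,i}, λ_{2,i} with ∇f(x̄) = Σ_{i=1}^m λ_{1,i}∇F_{1,i}(x̄) + λ_{2,i}∇F_{2,i}(x̄) such that for some index i either (λ_{1,i} < 0 and λ_{2,i} = 0) or (λ_{1,i} = 0 and λ_{2,i} < 0). -/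

import Mathlib

open Filter Topology
open scoped RealInnerProductSpace

noncomputable section

/-- Tangent (Bouligand) cone: w ∈ T_M(x) iff there are x_k ∈ M, x_k → x, τ_k ↓ 0
with (x_k - x)/τ_k → w. -/
def tangentCone {n : ℕ} (M : Set (EuclideanSpace ℝ (Fin n))) (x : EuclideanSpace ℝ (Fin n)) :
    Set (EuclideanSpace ℝ (Fin n)) :=
  {w | ∃ (xs : ℕ → EuclideanSpace ℝ (Fin n)) (τ : ℕ → ℝ),
    (∀ k, xs k ∈ M) ∧ Tendsto xs atTop (𝓝 x) ∧
    (∀ k, 0 < τ k) ∧ Tendsto τ atTop (𝓝 0) ∧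
    Tendsto (fun k => (τ k)⁻¹ • (xs k - x)) atTop (𝓝 w)}

/-- Fréchet normal cone: v with ⟨v, w⟩ ≤ 0 for all tangent directions w. -/
def frechetNormalCone {n : ℕ} (M : Set (EuclideanSpace ℝ (Fin n)))
    (x : EuclideanSpace ℝ (Fin n)) : Set (EuclideanSpace ℝ (Fin n)) :=
  {v | ∀ w ∈ tangentCone M x, ⟪v, w⟫ ≤ 0}

/-- Mordukhovich (limiting) normal cone. -/
def limitingNormalCone {n : ℕ} (M : Set (EuclideanSpace ℝ (Fin n)))
    (x : EuclideanSpace ℝ (Fin n)) : Set (EuclideanSpace ℝ (Fin n)) :=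
  {v | ∃ (xs vs : ℕ → EuclideanSpace ℝ (Fin n)),
    (∀ k, xs k ∈ M) ∧ Tendsto xs atTop (𝓝 x) ∧
    (∀ k, vs k ∈ frechetNormalCone M (xs k)) ∧ Tendsto vs atTop (𝓝 v)}

/-- Clarke normal cone: closed convex hull of the limiting normal cone. -/
def clarkeNormalCone {n : ℕ} (M : Set (EuclideanSpace ℝ (Fin n)))
    (x : EuclideanSpace ℝ (Fin n)) : Set (EuclideanSpace ℝ (Fin n)) :=
  closure (convexHull ℝ (limitingNormalCone M x))

/-- The MPCC feasible set. -/
def MpccSet {n m : ℕ} (F1 F2 : Fin m → EuclideanSpace ℝ (Fin n) → ℝ) :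
    Set (EuclideanSpace ℝ (Fin n)) :=
  {y | ∀ i, F1 i y * F2 i y = 0 ∧ 0 ≤ F1 i y ∧ 0 ≤ F2 i y}

/-- The linear combination map of a linearly independent finite family has a linear left inverse. -/
theorem LinearIndependent.exists_leftInverse_linearCombination {K V J : Type*} [Field K]
    [AddCommGroup V] [Module K V] [Fintype J] {g : J → V} (hg : LinearIndependent K g) :
    ∃ S : V →ₗ[K] J → K, ∀ c : J → K, S (∑ j, c j • g j) = c := by
  obtain ⟨S, hS⟩ := (Fintype.linearCombination K g).exists_leftInverse_of_injective
    (LinearMap.ker_eq_bot.2 hg.fintypeLinearCombination_injective)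
  exact ⟨S, fun c => by simpa [Fintype.linearCombination_apply] using LinearMap.congr_fun hS c⟩

/-- A linearly independent finite family in a Hilbert space has prescribed inner products with
some vector. -/
theorem LinearIndependent.exists_inner_eq {E J : Type*} [NormedAddCommGroup E]
    [InnerProductSpace ℝ E] [FiniteDimensional ℝ E] [Fintype J] {g : J → E}
    (hg : LinearIndependent ℝ g) (u : J → ℝ) : ∃ w : E, ∀ j, ⟪g j, w⟫ = u j := by
  classical
  obtain ⟨S, hS⟩ := hg.exists_leftInverse_linearCombination
  let φ : E →ₗ[ℝ] ℝ := ∑ j, u j • (LinearMap.proj j ∘ₗ S)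
  refine ⟨(InnerProductSpace.toDual ℝ E).symm (LinearMap.toContinuousLinearMap φ), fun j => ?_⟩
  have hj : S (g j) = Pi.single j 1 := by
    simpa [Pi.single_apply, ite_smul] using hS (Pi.single j 1)
  rw [real_inner_comm, InnerProductSpace.toDual_symm_apply]
  simp [φ, hj, Pi.single_apply]

/-- Coefficients with respect to converging families converge if the limit family is linearly
independent. -/
theorem LinearIndependent.exists_tendsto_coeff {E J : Type*} [NormedAddCommGroup E]
    [NormedSpace ℝ E] [FiniteDimensional ℝ E] [Fintype J] {g : J → E}
    (hg : LinearIndependent ℝ g) {gs : ℕ → J → E} {vs : ℕ → E} {cs : ℕ → J → ℝ} {v : E}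
    (hgs : ∀ j, Tendsto (fun k => gs k j) atTop (𝓝 (g j))) (hvs : Tendsto vs atTop (𝓝 v))
    (hcs : ∀ᶠ k in atTop, vs k = ∑ j, cs k j • gs k j) :
    ∃ c : J → ℝ, v = ∑ j, c j • g j ∧ Tendsto cs atTop (𝓝 c) := by
  obtain ⟨S, hS⟩ := hg.exists_leftInverse_linearCombination
  let S' : E →L[ℝ] J → ℝ := LinearMap.toContinuousLinearMap S
  let A : (J → E) → (J → ℝ) →L[ℝ] (J → ℝ) := fun h =>
    ∑ j, (ContinuousLinearMap.proj (R := ℝ) (φ := fun _ : J => ℝ) j).smulRight (S' (h j))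
  have hA : ∀ h c, A h c = S' (∑ j, c j • h j) := by
    intro h c
    simp [A, map_sum]
  have hAg : A g = 1 := by
    ext1 c
    rw [hA]
    exact hS c
  have hAlim : Tendsto (fun k => A (gs k)) atTop (𝓝 1) := by
    rw [← hAg]
    refine tendsto_finsetSum _ fun j _ => ?_
    exact ((ContinuousLinearMap.smulRightL ℝ (J → ℝ) (J → ℝ)
      (ContinuousLinearMap.proj (R := ℝ) (φ := fun _ : J => ℝ) j)).continuous.tendsto _).comp
      ((S'.continuous.tendsto _).comp (hgs j))
  have hunit : ∀ᶠ k in atTop, IsUnit (A (gs k)) :=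
    hAlim.eventually (Units.isOpen.mem_nhds isUnit_one)
  have hinv : Tendsto (fun k => Ring.inverse (A (gs k))) atTop (𝓝 1) := by
    have := (NormedRing.inverse_continuousAt (1 : ((J → ℝ) →L[ℝ] (J → ℝ))ˣ)).tendsto
    simp only [Units.val_one, Ring.inverse_one] at this
    exact this.comp hAlim
  have hlim : Tendsto cs atTop (𝓝 (S' v)) := by
    have h1 : Tendsto (fun k => Ring.inverse (A (gs k)) (S' (vs k))) atTop (𝓝 (S' v)) := by
      simpa [Function.comp_def] using (isBoundedBilinearMap_apply.continuous.tendsto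
        ((1 : (J → ℝ) →L[ℝ] (J → ℝ)), S' v)).comp
        (hinv.prodMk_nhds ((S'.continuous.tendsto _).comp hvs))
    refine h1.congr' ?_
    filter_upwards [hunit, hcs] with k hk hck
    rw [hck, ← hA, ← mul_apply_eq_comp, Ring.inverse_mul_cancel _ hk,
      one_apply_eq_self]
  refine ⟨S' v, tendsto_nhds_unique hvs ?_, hlim⟩
  refine Tendsto.congr' (hcs.mono fun k hk => hk.symm) ?_
  exact tendsto_finsetSum _ fun j _ => (tendsto_pi_nhds.1 hlim j).smul (hgs j)

/-- If the gradients of finitely many constraint functions are linearly independent, every direction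
is the velocity of a curve along which the constraints vary exactly linearly. -/
theorem exists_curve_of_linearIndependent_gradient {E J : Type*} [NormedAddCommGroup E]
    [InnerProductSpace ℝ E] [FiniteDimensional ℝ E] [Fintype J] {G : J → E → ℝ} {y : E}
    (hG : ∀ j, ContDiffAt ℝ 1 (G j) y)
    (hLI : LinearIndependent ℝ fun j => gradient (G j) y) (w : E) :
    ∃ z : ℝ → E, z 0 = y ∧ HasDerivAt z w 0 ∧
      ∀ᶠ t in 𝓝 0, ∀ j, G j (z t) = G j y + t * ⟪gradient (G j) y, w⟫ := by
  let Φ' : E →L[ℝ] J → ℝ := ContinuousLinearMap.pi fun j => fderiv ℝ (G j) y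
  have hΦ' : HasStrictFDerivAt (fun z j => G j z) Φ' y :=
    hasStrictFDerivAt_pi.2 fun j => (hG j).hasStrictFDerivAt one_ne_zero
  let K : Submodule ℝ E := (Φ' : E →ₗ[ℝ] J → ℝ).ker
  let P : E →L[ℝ] K := K.orthogonalProjectionOnto
  have hsurj : (Φ' : E →ₗ[ℝ] J → ℝ).range = ⊤ := by
    refine LinearMap.range_eq_top.2 fun u => ?_
    obtain ⟨w, hw⟩ := hLI.exists_inner_eq u
    refine ⟨w, funext fun j => ?_⟩
    simpa [Φ', inner_gradient_left] using hw j
  have hP : (P : E →ₗ[ℝ] K).range = ⊤ := LinearMap.range_eq_top.2 fun k =>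
    ⟨k, K.orthogonalProjectionOnto_mem_subspace_eq_self k⟩
  have hcompl : IsCompl (Φ' : E →ₗ[ℝ] J → ℝ).ker (P : E →ₗ[ℝ] K).ker := by
    rw [show (P : E →ₗ[ℝ] K).ker = Kᗮ from K.ker_orthogonalProjectionOnto]
    exact K.isCompl_orthogonal
  let L : E ≃L[ℝ] (J → ℝ) × K := Φ'.equivProdOfSurjectiveOfIsCompl P hsurj hP hcompl
  let H : E → (J → ℝ) × K := fun z => (fun j => G j z, P z)
  have hH : HasStrictFDerivAt H (L : E →L[ℝ] (J → ℝ) × K) y := hΦ'.prodMk P.hasStrictFDerivAt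
  let p : ℝ → (J → ℝ) × K := fun t => H y + t • L w
  have hp0 : p 0 = H y := by simp [p]
  have hp : HasDerivAt p (L w) 0 := by
    have := ((hasDerivAt_id (0 : ℝ)).smul_const (L w)).const_add (H y)
    rwa [one_smul] at this
  refine ⟨fun t => hH.localInverse H L y (p t), ?_, ?_, ?_⟩
  · simp only [hp0]
    exact hH.localInverse_apply_image
  · have := (hp0 ▸ hH.to_localInverse.hasFDerivAt).comp_hasDerivAt (0 : ℝ) hp
    simpa [Function.comp_def] using this
  · have hc : Tendsto p (𝓝 0) (𝓝 (H y)) := hp0 ▸ hp.continuousAt.tendsto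
    filter_upwards [hc.eventually hH.eventually_right_inverse] with t ht j
    have := congrFun (congrArg Prod.fst ht) j
    rw [inner_gradient_left]
    exact this

section

variable {n m : ℕ} {F1 F2 : Fin m → EuclideanSpace ℝ (Fin n) → ℝ}
  {y : EuclideanSpace ℝ (Fin n)}

theorem mem_tangentCone_of_hasDerivAt {M : Set (EuclideanSpace ℝ (Fin n))}
    {w : EuclideanSpace ℝ (Fin n)} {z : ℝ → EuclideanSpace ℝ (Fin n)} (hz0 : z 0 = y)
    (hz : HasDerivAt z w 0) (hM : ∀ᶠ t in 𝓝[>] 0, z t ∈ M) : w ∈ tangentCone M y := by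
  obtain ⟨τ, hτ⟩ : ∃ τ : ℕ → ℝ, Tendsto τ atTop (𝓝[>] 0) := exists_seq_tendsto _
  obtain ⟨N, hN⟩ := eventually_atTop.1 (hτ.eventually (hM.and self_mem_nhdsWithin))
  have hτN : Tendsto (fun k => τ (k + N)) atTop (𝓝[>] 0) := hτ.comp (tendsto_add_atTop_nat N)
  refine ⟨fun k => z (τ (k + N)), fun k => τ (k + N), fun k => (hN _ (by omega)).1, ?_,
    fun k => (hN _ (by omega)).2, hτN.mono_right nhdsWithin_le_nhds, ?_⟩
  · exact hz0 ▸ hz.continuousAt.tendsto.comp (hτN.mono_right nhdsWithin_le_nhds)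
  · have := hz.tendsto_slope_zero_right.comp hτN
    simpa [Function.comp_def, hz0] using this

/-- A direction along which the linearized constraints stay in the complementarity set for short
times is tangent to the MPCC feasible set, under linear independence of the gradients. -/
theorem mem_tangentCone_mpccSet (hF1 : ∀ i, ContDiff ℝ 1 (F1 i)) (hF2 : ∀ i, ContDiff ℝ 1 (F2 i))
    (hLI : LinearIndependent ℝ
      (Sum.elim (fun i => gradient (F1 i) y) (fun i => gradient (F2 i) y)))
    {w : EuclideanSpace ℝ (Fin n)}
    (hw : ∀ i, ∀ᶠ t in 𝓝[>] (0 : ℝ),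
      (F1 i y + t * ⟪gradient (F1 i) y, w⟫) * (F2 i y + t * ⟪gradient (F2 i) y, w⟫) = 0 ∧
      0 ≤ F1 i y + t * ⟪gradient (F1 i) y, w⟫ ∧ 0 ≤ F2 i y + t * ⟪gradient (F2 i) y, w⟫) :
    w ∈ tangentCone (MpccSet F1 F2) y := by
  have hLI' : LinearIndependent ℝ fun j => gradient (Sum.elim F1 F2 j) y := by
    have h : (fun j => gradient (Sum.elim F1 F2 j) y) =
        Sum.elim (fun i => gradient (F1 i) y) (fun i => gradient (F2 i) y) := by
      ext1 (i | i) <;> rfl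
    rwa [h]
  obtain ⟨z, hz0, hz, hzG⟩ := exists_curve_of_linearIndependent_gradient (G := Sum.elim F1 F2)
    (y := y) (by rintro (i | i) <;> simp [(hF1 _).contDiffAt, (hF2 _).contDiffAt])
    hLI' w
  refine mem_tangentCone_of_hasDerivAt hz0 hz ?_
  filter_upwards [hzG.filter_mono nhdsWithin_le_nhds, eventually_all.2 hw] with t ht htw i
  have h1 : F1 i (z t) = _ := ht (Sum.inl i)
  have h2 : F2 i (z t) = _ := ht (Sum.inr i)
  rw [h1, h2]
  exact htw i

/-- Multiplier representation of Fréchet normals to the MPCC feasible set. -/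
theorem exists_multipliers_of_mem_frechetNormalCone (hF1 : ∀ i, ContDiff ℝ 1 (F1 i))
    (hF2 : ∀ i, ContDiff ℝ 1 (F2 i))
    (hLI : LinearIndependent ℝ
      (Sum.elim (fun i => gradient (F1 i) y) (fun i => gradient (F2 i) y)))
    (hy : y ∈ MpccSet F1 F2) {v : EuclideanSpace ℝ (Fin n)}
    (hv : v ∈ frechetNormalCone (MpccSet F1 F2) y) :
    ∃ c : Fin m ⊕ Fin m → ℝ,
      v = ∑ j, c j • Sum.elim (fun i => gradient (F1 i) y) (fun i => gradient (F2 i) y) j ∧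
      ∀ i, (F1 i y ≠ 0 → c (Sum.inl i) = 0) ∧ (F2 i y ≠ 0 → c (Sum.inr i) = 0) ∧
        (F1 i y = 0 → F2 i y = 0 → c (Sum.inl i) ≤ 0 ∧ c (Sum.inr i) ≤ 0) := by
  set g := Sum.elim (fun i => gradient (F1 i) y) (fun i => gradient (F2 i) y) with hg
  have hker : ∀ w, (∀ j, ⟪g j, w⟫ = 0) → ⟪v, w⟫ ≤ 0 := by
    refine fun w hw => hv w (mem_tangentCone_mpccSet hF1 hF2 hLI fun i => ?_)
    have h1 : ⟪gradient (F1 i) y, w⟫ = 0 := hw (Sum.inl i)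
    have h2 : ⟪gradient (F2 i) y, w⟫ = 0 := hw (Sum.inr i)
    exact Eventually.of_forall fun _ => by simpa [h1, h2] using hy i
  have hspan : v ∈ Submodule.span ℝ (Set.range g) := by
    rw [← Submodule.orthogonal_orthogonal (Submodule.span ℝ (Set.range g)),
      Submodule.mem_orthogonal']
    intro w hw
    have hgw : ∀ j, ⟪g j, w⟫ = 0 := fun j =>
      (Submodule.mem_orthogonal _ _).1 hw _ (Submodule.subset_span ⟨j, rfl⟩)
    refine le_antisymm (hker w hgw) ?_
    have := hker (-w) fun j => by simp [hgw j]
    simpa using this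
  obtain ⟨c, hc⟩ := (Submodule.mem_span_range_iff_exists_fun ℝ).1 hspan
  have hsingle : ∀ j s, (∀ w, (∀ k, ⟪g k, w⟫ = Pi.single (M := fun _ => ℝ) j s k) →
      w ∈ tangentCone (MpccSet F1 F2) y) → c j * s ≤ 0 := by
    intro j s h
    obtain ⟨w, hw⟩ := hLI.exists_inner_eq (Pi.single j s)
    have := hv w (h w hw)
    rw [← hc, sum_inner] at this
    simpa [inner_smul_left, hw, Pi.single_apply] using this
  have hcoord1 : ∀ i s, F2 i y = 0 → (∀ᶠ t in 𝓝[>] (0 : ℝ), 0 ≤ F1 i y + t * s) →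
      c (Sum.inl i) * s ≤ 0 := by
    intro i s hi hs
    refine hsingle _ _ fun w hw => mem_tangentCone_mpccSet hF1 hF2 hLI fun l => ?_
    have h1 : ⟪gradient (F1 l) y, w⟫ = _ := hw (Sum.inl l)
    have h2 : ⟪gradient (F2 l) y, w⟫ = _ := hw (Sum.inr l)
    rw [h1, h2]
    rcases eq_or_ne l i with rfl | hl
    · simpa [hi] using hs
    · exact Eventually.of_forall fun _ => by simpa [Pi.single_apply, hl] using hy l
  have hcoord2 : ∀ i s, F1 i y = 0 → (∀ᶠ t in 𝓝[>] (0 : ℝ), 0 ≤ F2 i y + t * s) →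
      c (Sum.inr i) * s ≤ 0 := by
    intro i s hi hs
    refine hsingle _ _ fun w hw => mem_tangentCone_mpccSet hF1 hF2 hLI fun l => ?_
    have h1 : ⟪gradient (F1 l) y, w⟫ = _ := hw (Sum.inl l)
    have h2 : ⟪gradient (F2 l) y, w⟫ = _ := hw (Sum.inr l)
    rw [h1, h2]
    rcases eq_or_ne l i with rfl | hl
    · simpa [hi] using hs
    · exact Eventually.of_forall fun _ => by simpa [Pi.single_apply, hl] using hy l
  have hpos : ∀ a : ℝ, 0 ≤ a → ∀ᶠ t in 𝓝[>] (0 : ℝ), 0 ≤ a + t * 1 := by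
    intro a ha
    filter_upwards [self_mem_nhdsWithin] with t (ht : 0 < t)
    linarith
  have hneg : ∀ a : ℝ, 0 < a → ∀ᶠ t in 𝓝[>] (0 : ℝ), 0 ≤ a + t * (-1) := by
    intro a ha
    filter_upwards [Ioo_mem_nhdsGT ha] with t ht
    linarith [ht.2]
  refine ⟨c, hc.symm, fun i => ⟨fun h => ?_, fun h => ?_, fun h1 h2 => ⟨?_, ?_⟩⟩⟩
  · have h2 : F2 i y = 0 := (mul_eq_zero.1 (hy i).1).resolve_left h
    linarith [hcoord1 i 1 h2 (hpos _ (hy i).2.1),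
      hcoord1 i (-1) h2 (hneg _ (lt_of_le_of_ne' (hy i).2.1 h))]
  · have h1 : F1 i y = 0 := (mul_eq_zero.1 (hy i).1).resolve_right h
    linarith [hcoord2 i 1 h1 (hpos _ (hy i).2.2),
      hcoord2 i (-1) h1 (hneg _ (lt_of_le_of_ne' (hy i).2.2 h))]
  · linarith [hcoord1 i 1 h2 (hpos _ (hy i).2.1)]
  · linarith [hcoord2 i 1 h1 (hpos _ (hy i).2.2)]

/-- A constraint function that is nonnegative on a set and vanishes at a point of reference has
nonnegative derivative along tangent directions. -/
theorem inner_gradient_nonneg_of_mem_tangentCone {M : Set (EuclideanSpace ℝ (Fin n))}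
    {G : EuclideanSpace ℝ (Fin n) → ℝ} (hG : DifferentiableAt ℝ G y) (hGy : G y = 0)
    (hM : ∀ z ∈ M, 0 ≤ G z) {w : EuclideanSpace ℝ (Fin n)} (hw : w ∈ tangentCone M y) :
    0 ≤ ⟪gradient G y, w⟫ := by
  obtain ⟨xs, τ, hxs, hlim, hτ, -, hd⟩ := hw
  have := hG.hasFDerivAt.hasFDerivWithinAt (s := Set.univ) |>.lim (d := fun k => xs k - y)
    (by simpa using hlim.sub_const y) (by simp) hd
  rw [inner_gradient_left]
  refine ge_of_tendsto' this fun k => ?_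
  simpa [hGy] using mul_nonneg (inv_nonneg.2 (hτ k).le) (hM _ (hxs k))

theorem sum_mem_frechetNormalCone_of_nonpos (hF1 : ∀ i, ContDiff ℝ 1 (F1 i))
    (hF2 : ∀ i, ContDiff ℝ 1 (F2 i)) (hbi : ∀ i, F1 i y = 0 ∧ F2 i y = 0)
    {c : Fin m ⊕ Fin m → ℝ} (hc : ∀ j, c j ≤ 0) :
    ∑ j, c j • Sum.elim (fun i => gradient (F1 i) y) (fun i => gradient (F2 i) y) j ∈
      frechetNormalCone (MpccSet F1 F2) y := by
  intro w hw
  rw [sum_inner]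
  refine Finset.sum_nonpos fun j _ => ?_
  rw [real_inner_smul_left]
  refine mul_nonpos_of_nonpos_of_nonneg (hc j) ?_
  rcases j with i | i
  · exact inner_gradient_nonneg_of_mem_tangentCone ((hF1 i).differentiable one_ne_zero y)
      (hbi i).1 (fun z hz => (hz i).2.1) hw
  · exact inner_gradient_nonneg_of_mem_tangentCone ((hF2 i).differentiable one_ne_zero y)
      (hbi i).2 (fun z hz => (hz i).2.2) hw

/-- Multiplier representation of limiting normals to the MPCC feasible set. -/
theorem exists_multipliers_of_mem_limitingNormalCone (hF1 : ∀ i, ContDiff ℝ 1 (F1 i))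
    (hF2 : ∀ i, ContDiff ℝ 1 (F2 i))
    (hLI : LinearIndependent ℝ
      (Sum.elim (fun i => gradient (F1 i) y) (fun i => gradient (F2 i) y)))
    {v : EuclideanSpace ℝ (Fin n)} (hv : v ∈ limitingNormalCone (MpccSet F1 F2) y) :
    ∃ c : Fin m ⊕ Fin m → ℝ,
      v = ∑ j, c j • Sum.elim (fun i => gradient (F1 i) y) (fun i => gradient (F2 i) y) j ∧
      ∀ i, c (Sum.inl i) * c (Sum.inr i) = 0 ∨ (c (Sum.inl i) ≤ 0 ∧ c (Sum.inr i) ≤ 0) := by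
  obtain ⟨xs, vs, hxs, hlim, hvs, hvlim⟩ := hv
  let g : EuclideanSpace ℝ (Fin n) → Fin m ⊕ Fin m → EuclideanSpace ℝ (Fin n) := fun z =>
    Sum.elim (fun i => gradient (F1 i) z) (fun i => gradient (F2 i) z)
  have hcont : ∀ {G : EuclideanSpace ℝ (Fin n) → ℝ}, ContDiff ℝ 1 G → Continuous (gradient G) :=
    fun hG => (InnerProductSpace.toDual ℝ _).symm.continuous.comp (hG.continuous_fderiv one_ne_zero)
  have hgs : ∀ j, Tendsto (fun k => g (xs k) j) atTop (𝓝 (g y j)) := by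
    rintro (i | i)
    · exact ((hcont (hF1 i)).tendsto y).comp hlim
    · exact ((hcont (hF2 i)).tendsto y).comp hlim
  have hLIk : ∀ᶠ k in atTop, LinearIndependent ℝ (g (xs k)) :=
    (tendsto_pi_nhds.2 hgs).eventually hLI.eventually
  have hex : ∀ k, ∃ c : Fin m ⊕ Fin m → ℝ, LinearIndependent ℝ (g (xs k)) →
      vs k = ∑ j, c j • g (xs k) j ∧
      ∀ i, c (Sum.inl i) * c (Sum.inr i) = 0 ∨ (c (Sum.inl i) ≤ 0 ∧ c (Sum.inr i) ≤ 0) := by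
    intro k
    by_cases h : LinearIndependent ℝ (g (xs k))
    · obtain ⟨c, hc, hsign⟩ :=
        exists_multipliers_of_mem_frechetNormalCone hF1 hF2 h (hxs k) (hvs k)
      refine ⟨c, fun _ => ⟨hc, fun i => ?_⟩⟩
      obtain ⟨h1, h2, h3⟩ := hsign i
      by_cases hz1 : F1 i (xs k) = 0
      · by_cases hz2 : F2 i (xs k) = 0
        · exact Or.inr (h3 hz1 hz2)
        · exact Or.inl (by rw [h2 hz2, mul_zero])
      · exact Or.inl (by rw [h1 hz1, zero_mul])
    · exact ⟨0, fun h' => absurd h' h⟩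
  choose cs hcs using hex
  obtain ⟨c, hc, hclim⟩ := hLI.exists_tendsto_coeff hgs hvlim
    (hLIk.mono fun k hk => (hcs k hk).1)
  refine ⟨c, hc, fun i => ?_⟩
  have hclosed : IsClosed {p : ℝ × ℝ | p.1 * p.2 = 0 ∨ (p.1 ≤ 0 ∧ p.2 ≤ 0)} :=
    (isClosed_eq (by fun_prop) continuous_const).union
      ((isClosed_le continuous_fst continuous_const).inter
        (isClosed_le continuous_snd continuous_const))
  exact hclosed.mem_of_tendsto
    ((tendsto_pi_nhds.1 hclim (Sum.inl i)).prodMk_nhds (tendsto_pi_nhds.1 hclim (Sum.inr i)))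
    (hLIk.mono fun k hk => (hcs k hk).2 i)

end

/-- A limiting-normal stationary point of MPCC (biactive, SNO-LICQ) fails to be Fréchet
stationary iff it is a singular saddle point of first order. -/
theorem mpcc_N_not_frechet_iff_singular_saddle {n m : ℕ}
    (f : EuclideanSpace ℝ (Fin n) → ℝ) (F1 F2 : Fin m → EuclideanSpace ℝ (Fin n) → ℝ)
    (hf : ContDiff ℝ 1 f) (hF1 : ∀ i, ContDiff ℝ 1 (F1 i)) (hF2 : ∀ i, ContDiff ℝ 1 (F2 i))
    (x : EuclideanSpace ℝ (Fin n))
    (hbi : ∀ i, F1 i x = 0 ∧ F2 i x = 0)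
    (hLICQ : LinearIndependent ℝ
      (Sum.elim (fun i => gradient (F1 i) x) (fun i => gradient (F2 i) x)))
    (hN : -gradient f x ∈ limitingNormalCone (MpccSet F1 F2) x) :
    -gradient f x ∉ frechetNormalCone (MpccSet F1 F2) x ↔
      ∃ l1 l2 : Fin m → ℝ,
        gradient f x = ∑ i, (l1 i • gradient (F1 i) x + l2 i • gradient (F2 i) x) ∧
        ∃ i, (l1 i < 0 ∧ l2 i = 0) ∨ (l1 i = 0 ∧ l2 i < 0) := by
  constructor
  · intro hnot
    obtain ⟨c, hc, hsign⟩ := exists_multipliers_of_mem_limitingNormalCone hF1 hF2 hLICQ hN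
    refine ⟨fun i => -c (Sum.inl i), fun i => -c (Sum.inr i), ?_, ?_⟩
    · rw [← neg_neg (gradient f x), hc, Fintype.sum_sum_type, ← Finset.sum_add_distrib,
        ← Finset.sum_neg_distrib]
      exact Finset.sum_congr rfl fun i _ => by simp [add_comm]
    · by_contra! hcon
      refine hnot (hc ▸ sum_mem_frechetNormalCone_of_nonpos hF1 hF2 hbi ?_)
      rintro (i | i)
      · by_contra! h
        rcases hsign i with h0 | h0
        · exact (hcon i).1 (by linarith) (by simpa using (mul_eq_zero.1 h0).resolve_left h.ne')
        · linarith [h0.1]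
      · by_contra! h
        rcases hsign i with h0 | h0
        · have := (hcon i).2 (by simpa using (mul_eq_zero.1 h0).resolve_right h.ne')
          linarith
        · linarith [h0.2]
  · rintro ⟨l1, l2, hl, i, hi⟩ hfre
    have hxM : x ∈ MpccSet F1 F2 := fun i => by simp [hbi i]
    obtain ⟨c, hc, hsign⟩ :=
      exists_multipliers_of_mem_frechetNormalCone hF1 hF2 hLICQ hxM hfre
    have hzero : ∑ j, (c j + Sum.elim l1 l2 j) •
        Sum.elim (fun i => gradient (F1 i) x) (fun i => gradient (F2 i) x) j = 0 := by
      simp only [add_smul, Finset.sum_add_distrib, ← hc]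
      rw [hl, Fintype.sum_sum_type]
      simp [Finset.sum_add_distrib]
    have hcoef := Fintype.linearIndependent_iff.1 hLICQ _ hzero
    have h1 : c (Sum.inl i) + l1 i = 0 := hcoef (Sum.inl i)
    have h2 : c (Sum.inr i) + l2 i = 0 := hcoef (Sum.inr i)
    obtain ⟨hc1, hc2⟩ := (hsign i).2.2 (hbi i).1 (hbi i).2
    rcases hi with hi | hi
    · linarith [hi.1]
    · linarith [hi.2]
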